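/- arXiv:2502.20987 — 2 statements merged into one kernel-verified Lean document; each statement's English description precedes it below -/
import Mathlib

section
/- Let G be a finite simple graph and e an edge of G. Then the face contraction Δ(G)/e of the clique complex of G equals the clique complex Δ(G/e) of the edge contraction G/e if and only if there is no induced subgraph of G isomorphic to the 4-cycle C₄ containing both endpoints of e. -/
open SimpleGraph Finset

/-- A simplicial complex on the vertex type `V`: closed under subsets and
containing every singleton. -/
def IsComplex {V : Type*} (Δ : Set (Finset V)) : Prop :=
  (∀ F ∈ Δ, ∀ G : Finset V, G ⊆ F → G ∈ Δ) ∧ (∀ v : V, ({v} : Finset V) ∈ Δ)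

/-- The `q`-secant complex `σ_q Δ`: its faces are unions of `q` faces of `Δ`. -/
def secant {V : Type*} [DecidableEq V] (q : ℕ) (Δ : Set (Finset V)) : Set (Finset V) :=
  {F | ∃ f : Fin q → Finset V, (∀ i, f i ∈ Δ) ∧ F = Finset.univ.sup f}

/-- Clique complex of a graph. -/
def cliqueComplex {V : Type*} (G : SimpleGraph V) : Set (Finset V) :=
  {F | G.IsClique (F : Set V)}

/-- `S` is a union of `q` cliques of `G`. -/
def CliqueCoverable {V : Type*} (G : SimpleGraph V) (q : ℕ) (S : Set V) : Prop :=
  ∃ f : Fin q → Set V, (∀ i, G.IsClique (f i)) ∧ S = ⋃ i, f i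

/-- Membership in the family `𝓕_{q,1}`: `H` is not the edgeless graph on `q+1`
vertices, its vertex set is not a union of `q` cliques, but every proper subset is. -/
def MemF1 {V : Type*} [Fintype V] (q : ℕ) (H : SimpleGraph V) : Prop :=
  ¬(Fintype.card V = q + 1 ∧ H = ⊥) ∧
  ¬CliqueCoverable H q Set.univ ∧
  ∀ S : Set V, S ≠ Set.univ → CliqueCoverable H q S

/-- `𝓕_{q,1}`-freeness: no induced subgraph belongs to `𝓕_{q,1}`. -/
def F1Free {V : Type*} [Fintype V] [DecidableEq V] (q : ℕ) (G : SimpleGraph V) : Prop :=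
  ∀ S : Finset V, ¬MemF1 q (G.induce (S : Set V))

/-- Elementary bipartite graph: a bipartite graph such that removing any vertex from
each side leaves a graph with a perfect matching. -/
def ElemBipartite {V : Type*} (H : SimpleGraph V) : Prop :=
  ∃ U W : Set V, Disjoint U W ∧ U ∪ W = Set.univ ∧
    (∀ a b, H.Adj a b → (a ∈ U ∧ b ∈ W) ∨ (a ∈ W ∧ b ∈ U)) ∧
    ∀ u ∈ U, ∀ w ∈ W, ∃ M : H.Subgraph, M.verts = Set.univ \ {u, w} ∧ M.IsMatching

/-- Membership in the family `𝓕_{q,2}`: a disjoint union of an elementary bipartite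
graph on `2j+2` vertices (1 ≤ j ≤ q) with `q - j` isolated vertices. -/
def MemF2 {V : Type*} [Fintype V] [DecidableEq V] (q : ℕ) (G : SimpleGraph V) : Prop :=
  ∃ j : ℕ, 1 ≤ j ∧ j ≤ q ∧ ∃ S : Finset V,
    S.card = 2 * j + 2 ∧ Fintype.card V = (2 * j + 2) + (q - j) ∧
    (∀ a b, G.Adj a b → a ∈ S ∧ b ∈ S) ∧
    ElemBipartite (G.induce (S : Set V))

/-- `𝓕_{q,2}`-freeness. -/
def F2Free {V : Type*} [Fintype V] [DecidableEq V] (q : ℕ) (G : SimpleGraph V) : Prop :=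
  ∀ S : Finset V, ¬MemF2 q (G.induce (S : Set V))

/-- `G` has no induced cycle `C_n`. -/
def CycleFree {V : Type*} [Fintype V] [DecidableEq V] (G : SimpleGraph V) (n : ℕ) : Prop :=
  ∀ S : Finset V, IsEmpty (G.induce (S : Set V) ≃g cycleGraph n)

/-- `q`-secant chordality: `𝓕_{q,1}`-free, `𝓕_{q,2}`-free and `C_{2q+p}`-free for all `p ≥ 3`. -/
def SecantChordal {V : Type*} [Fintype V] [DecidableEq V] (q : ℕ) (G : SimpleGraph V) : Prop :=
  F1Free q G ∧ F2Free q G ∧ ∀ p : ℕ, 3 ≤ p → CycleFree G (2 * q + p)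

/-- Edge contraction `G/e` where `e = {u, v}`: the vertex `u` is removed and `v` plays
the role of the new identified vertex `z`, which is adjacent to every vertex adjacent
in `G` to `u` or to `v`; other adjacencies are unchanged. -/
def contractEdge {V : Type*} (G : SimpleGraph V) (u v : V) :
    SimpleGraph {a : V // a ≠ u} :=
  SimpleGraph.fromRel (fun a b =>
    G.Adj a.1 b.1 ∨ (a.1 = v ∧ G.Adj u b.1) ∨ (b.1 = v ∧ G.Adj a.1 u))

/-- Independent set: a set of pairwise nonadjacent vertices. -/
def IsIndepSet {V : Type*} (G : SimpleGraph V) (S : Set V) : Prop :=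
  ∀ a ∈ S, ∀ b ∈ S, a ≠ b → ¬G.Adj a b

/-- The contraction of a complex `Γ` by the edge `{u, v}`: the vertex `u` is removed
and `v` plays the role of the new vertex `z` (matching the convention of
`contractEdge` for graphs). -/
def edgeContractCx {V : Type*} [DecidableEq V] (Γ : Set (Finset V)) (u v : V)
    (hvu : v ≠ u) : Set (Finset {a : V // a ≠ u}) :=
  {G' | ∃ G ∈ Γ,
    ((u ∈ G ∨ v ∈ G) ∧
      G' = insert ⟨v, hvu⟩ (((G.erase u).erase v).subtype (· ≠ u))) ∨
    ((u ∉ G ∧ v ∉ G) ∧ G' = G.subtype (· ≠ u))}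

theorem c4_iff_aux {V : Type*} [DecidableEq V] (G : SimpleGraph V) (u v : V)
    (hadj : G.Adj u v) :
    (∃ S : Finset V, u ∈ S ∧ v ∈ S ∧ Nonempty (G.induce (S : Set V) ≃g cycleGraph 4)) ↔
      ∃ a b, a ≠ v ∧ b ≠ u ∧ G.Adj u a ∧ G.Adj a b ∧ G.Adj b v ∧ ¬ G.Adj v a ∧ ¬ G.Adj u b := by
  constructor
  · rintro ⟨S, hu, hv, ⟨φ⟩⟩
    have key : ∀ i j : Fin 4, (cycleGraph 4).Adj i j → ∃ k l : Fin 4, k ≠ j ∧ l ≠ i ∧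
        (cycleGraph 4).Adj i k ∧ (cycleGraph 4).Adj k l ∧ (cycleGraph 4).Adj l j ∧
        ¬ (cycleGraph 4).Adj j k ∧ ¬ (cycleGraph 4).Adj i l := by decide
    have hφ : ∀ x y, (cycleGraph 4).Adj (φ x) (φ y) ↔ G.Adj x.1 y.1 := fun x y => φ.map_rel_iff
    obtain ⟨k, l, h1, h2, h3, h4, h5, h6, h7⟩ :=
      key (φ ⟨u, hu⟩) (φ ⟨v, hv⟩) ((hφ _ _).2 hadj)
    obtain ⟨a, rfl⟩ := φ.surjective k
    obtain ⟨b, rfl⟩ := φ.surjective l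
    rw [hφ] at h3 h4 h5 h6 h7
    refine ⟨a.1, b.1, ?_, ?_, h3, h4, h5, h6, h7⟩
    · intro h; exact h1 (congrArg φ (Subtype.ext h))
    · intro h; exact h2 (congrArg φ (Subtype.ext h))
  · rintro ⟨a, b, h1, h2, h3, h4, h5, h6, h7⟩
    let f : Fin 4 → V := ![u, v, b, a]
    have hf : Function.Injective f := by
      have e1 := hadj.ne
      have e2 := h3.ne
      have e3 := h4.ne
      have e4 := h5.ne
      intro i j h
      fin_cases i <;> fin_cases j <;> simp [f] at h ⊢ <;> grind
    have hA : ∀ i j, G.Adj (f i) (f j) ↔ (cycleGraph 4).Adj i j := by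
      have h3' := h3.symm
      have h4' := h4.symm
      have h5' := h5.symm
      have h6' : ¬ G.Adj a v := fun h => h6 h.symm
      have h7' : ¬ G.Adj b u := fun h => h7 h.symm
      have h0 := hadj.symm
      intro i j
      fin_cases i <;> fin_cases j <;> simp [f, *] <;> decide
    refine ⟨Finset.univ.image f, ?_, ?_, ⟨RelIso.symm ⟨Equiv.ofBijective
      (fun i => ⟨f i, by simp⟩) ⟨?_, ?_⟩, ?_⟩⟩⟩
    · exact Finset.mem_image.2 ⟨0, by simp, rfl⟩
    · exact Finset.mem_image.2 ⟨1, by simp, rfl⟩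
    · intro i j h
      exact hf (congrArg Subtype.val h)
    · rintro ⟨x, hx⟩
      obtain ⟨i, -, rfl⟩ := Finset.mem_image.1 (Finset.mem_coe.1 hx)
      exact ⟨i, rfl⟩
    · intro i j
      exact hA i j

theorem contractEdge_adj_aux {V : Type*} (G : SimpleGraph V) (u v : V) (a b : {a : V // a ≠ u}) :
    (contractEdge G u v).Adj a b ↔ a.1 ≠ b.1 ∧
      (G.Adj a.1 b.1 ∨ (a.1 = v ∧ G.Adj u b.1) ∨ (b.1 = v ∧ G.Adj u a.1)) := by
  simp only [contractEdge, SimpleGraph.fromRel_adj, ne_eq, Subtype.ext_iff, G.adj_comm b.1 a.1,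
    G.adj_comm b.1 u, G.adj_comm a.1 u]
  tauto

theorem mem_cc_aux {V : Type*} (G : SimpleGraph V) (F : Finset V) :
    F ∈ cliqueComplex G ↔ ∀ a ∈ F, ∀ b ∈ F, a ≠ b → G.Adj a b := by
  simp [cliqueComplex, SimpleGraph.IsClique, Set.Pairwise]

/-- `Δ(G)/e = Δ(G/e)` iff no induced `C₄` of `G` contains both
endpoints of `e`. -/
theorem cliqueComplex_contract_eq_iff {V : Type*} [Fintype V] [DecidableEq V]
    (G : SimpleGraph V) (u v : V) (hadj : G.Adj u v) :
    edgeContractCx (cliqueComplex G) u v hadj.ne' = cliqueComplex (contractEdge G u v) ↔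
      ∀ S : Finset V, u ∈ S → v ∈ S →
        IsEmpty (G.induce (S : Set V) ≃g cycleGraph 4) := by
  have hvu : v ≠ u := hadj.ne'
  have hR : (∀ S : Finset V, u ∈ S → v ∈ S → IsEmpty (G.induce (S : Set V) ≃g cycleGraph 4)) ↔
      ¬ ∃ a b, a ≠ v ∧ b ≠ u ∧ G.Adj u a ∧ G.Adj a b ∧ G.Adj b v ∧ ¬ G.Adj v a ∧
        ¬ G.Adj u b := by
    rw [← c4_iff_aux G u v hadj]
    simp only [not_exists, not_and, not_nonempty_iff]
  rw [hR]
  constructor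
  · rintro h ⟨a, b, h1, h2, h3, h4, h5, h6, h7⟩
    have hau : a ≠ u := h3.ne'
    have hbv : b ≠ v := h5.ne
    have hab : a ≠ b := h4.ne
    have hm : ({⟨v, hvu⟩, ⟨a, hau⟩, ⟨b, h2⟩} : Finset {a : V // a ≠ u}) ∈
        cliqueComplex (contractEdge G u v) := by
      rw [mem_cc_aux]
      have := h4.symm
      have := h5.symm
      intro x hx y hy hxy
      rw [contractEdge_adj_aux]
      simp only [Finset.mem_insert, Finset.mem_singleton] at hx hy
      refine ⟨fun h => hxy (Subtype.ext h), ?_⟩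
      rcases hx with rfl | rfl | rfl <;> rcases hy with rfl | rfl | rfl <;> simp_all
    rw [← h] at hm
    obtain ⟨F, hF, ⟨hFuv, hEq⟩ | ⟨⟨-, hvF⟩, hEq⟩⟩ := hm
    · rw [mem_cc_aux] at hF
      have ha : a ∈ F := by
        have : (⟨a, hau⟩ : {a : V // a ≠ u}) ∈ ({⟨v, hvu⟩, ⟨a, hau⟩, ⟨b, h2⟩} : Finset _) := by
          simp
        rw [hEq] at this
        simpa [h1, hau] using this
      have hb : b ∈ F := by
        have : (⟨b, h2⟩ : {a : V // a ≠ u}) ∈ ({⟨v, hvu⟩, ⟨a, hau⟩, ⟨b, h2⟩} : Finset _) := by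
          simp
        rw [hEq] at this
        simpa [h2, hbv] using this
      rcases hFuv with hu | hv
      · exact h7 (hF u hu b hb h2.symm)
      · exact h6 (hF v hv a ha h1.symm)
    · have : (⟨v, hvu⟩ : {a : V // a ≠ u}) ∈ ({⟨v, hvu⟩, ⟨a, hau⟩, ⟨b, h2⟩} : Finset _) := by
        simp
      rw [hEq] at this
      exact hvF (by simpa using this)
  · intro h
    ext F'
    rw [mem_cc_aux]
    constructor
    · rintro ⟨F, hF, ⟨hFuv, rfl⟩ | ⟨⟨huF, hvF⟩, rfl⟩⟩
      · rw [mem_cc_aux] at hF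
        rintro ⟨x, hxu⟩ hx ⟨y, hyu⟩ hy hxy
        rw [contractEdge_adj_aux]
        have hxy' : x ≠ y := fun h => hxy (Subtype.ext h)
        simp only [Finset.mem_insert, Finset.mem_subtype, Finset.mem_erase, Subtype.mk.injEq]
          at hx hy
        refine ⟨hxy', ?_⟩
        have := G.adj_comm x v
        grind
      · rw [mem_cc_aux] at hF
        rintro ⟨x, hxu⟩ hx ⟨y, hyu⟩ hy hxy
        rw [contractEdge_adj_aux]
        have hxy' : x ≠ y := fun h => hxy (Subtype.ext h)
        simp only [Finset.mem_subtype] at hx hy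
        exact ⟨hxy', Or.inl (hF _ hx _ hy hxy')⟩
    · intro hF
      have hF1 : ∀ x (hx : x ≠ u), (⟨x, hx⟩ : {a : V // a ≠ u}) ∈ F' → ∀ y (hy : y ≠ u),
          (⟨y, hy⟩ : {a : V // a ≠ u}) ∈ F' → x ≠ y → 
          (G.Adj x y ∨ (x = v ∧ G.Adj u y) ∨ (y = v ∧ G.Adj u x)) := by
        intro x hx hxF y hy hyF hxy
        have := hF _ hxF _ hyF (by simpa using hxy)
        rw [contractEdge_adj_aux] at this
        exact this.2
      let K : Finset V := (F'.image Subtype.val).erase v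
      have hK : ∀ x, x ∈ K ↔ x ≠ v ∧ ∃ hx : x ≠ u, (⟨x, hx⟩ : {a : V // a ≠ u}) ∈ F' := by
        intro x; simp [K]
      have hKK : ∀ x ∈ K, ∀ y ∈ K, x ≠ y → G.Adj x y := by
        intro x hx y hy hxy
        obtain ⟨hxv, hxu, hxF⟩ := (hK x).1 hx
        obtain ⟨hyv, hyu, hyF⟩ := (hK y).1 hy
        have := hF1 x hxu hxF y hyu hyF hxy
        tauto
      by_cases hv : (⟨v, hvu⟩ : {a : V // a ≠ u}) ∈ F'
      · have hw : ∃ w, (w = u ∨ w = v) ∧ ∀ x ∈ K, G.Adj w x := by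
          by_contra hcon
          push Not at hcon
          obtain ⟨b, hb, hub⟩ := hcon u (Or.inl rfl)
          obtain ⟨a, ha, hva⟩ := hcon v (Or.inr rfl)
          obtain ⟨hav, hau, haF⟩ := (hK a).1 ha
          obtain ⟨hbv, hbu, hbF⟩ := (hK b).1 hb
          have h1 := hF1 v hvu hv a hau haF hav.symm
          have h2 := hF1 v hvu hv b hbu hbF hbv.symm
          have hua : G.Adj u a := by tauto
          have hvb : G.Adj v b := by tauto
          have hab : a ≠ b := by rintro rfl; exact hub hua
          exact h ⟨a, b, hav, hbu, hua, hKK a ha b hb hab, hvb.symm, hva, hub⟩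
        obtain ⟨w, hw, hwK⟩ := hw
        refine ⟨insert w K, ?_, Or.inl ⟨?_, ?_⟩⟩
        · rw [mem_cc_aux]
          intro x hx y hy hxy
          rw [Finset.mem_insert] at hx hy
          rcases hx with rfl | hx <;> rcases hy with rfl | hy
          · exact absurd rfl hxy
          · exact hwK _ hy
          · exact (hwK _ hx).symm
          · exact hKK _ hx _ hy hxy
        · rcases hw with rfl | rfl <;> simp
        · ext ⟨x, hx⟩
          simp only [Finset.mem_insert, Finset.mem_subtype, Finset.mem_erase, Subtype.mk.injEq, hK]
          grind
      · refine ⟨K, (mem_cc_aux G K).2 hKK, Or.inr ⟨⟨?_, ?_⟩, ?_⟩⟩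
        · simp [hK]
        · simp [hK]
        · ext ⟨x, hx⟩
          simp only [Finset.mem_subtype, hK]
          grind
end

section
/- Let q₁, q₂ ≥ 2 be integers and let G₁ and G₂ be finite simple graphs with G₁ ∈ F_{q₁,1} and G₂ ∈ F_{q₂,1}. Then the disjoint union G₁ ⊔ G₂ belongs to F_{q₁+q₂+1,1}. -/
open SimpleGraph Finset

/-- Disjoint union of two graphs, on the sum of their vertex types. -/
def disjUnionGraph {A B : Type*} (G₁ : SimpleGraph A) (G₂ : SimpleGraph B) :
    SimpleGraph (A ⊕ B) :=
  SimpleGraph.fromRel (fun x y =>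
    (∃ a a', x = Sum.inl a ∧ y = Sum.inl a' ∧ G₁.Adj a a') ∨
    (∃ b b', x = Sum.inr b ∧ y = Sum.inr b' ∧ G₂.Adj b b'))

theorem cc_of {V ι : Type*} [Fintype ι] {G : SimpleGraph V} {q : ℕ} {S : Set V}
    (hc : Fintype.card ι ≤ q) (f : ι → Set V) (hf : ∀ i, G.IsClique (f i))
    (hS : ∀ x ∈ S, ∃ i, x ∈ f i) : CliqueCoverable G q S := by
  obtain ⟨e⟩ : Nonempty (ι ↪ Fin q) :=
    Function.Embedding.nonempty_of_card_le (by simpa using hc)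
  refine ⟨fun k => {x | x ∈ S ∧ ∃ i, e i = k ∧ x ∈ f i}, ?_, ?_⟩
  · rintro k x ⟨_, i, hi, hx⟩ y ⟨_, j, hj, hy⟩ hxy
    have : i = j := e.injective (hi.trans hj.symm)
    subst this
    exact hf i hx hy hxy
  · ext x
    simp only [Set.mem_iUnion, Set.mem_setOf_eq]
    constructor
    · intro hx
      obtain ⟨i, hi⟩ := hS x hx
      exact ⟨e i, hx, i, rfl, hi⟩
    · rintro ⟨_, hx, _⟩
      exact hx

theorem du_ll {A B : Type*} {G₁ : SimpleGraph A} {G₂ : SimpleGraph B} (a a' : A) :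
    (disjUnionGraph G₁ G₂).Adj (Sum.inl a) (Sum.inl a') ↔ G₁.Adj a a' := by
  simp only [disjUnionGraph, SimpleGraph.fromRel_adj]
  have := G₁.symm
  have h2 := G₁.ne_of_adj (a := a) (b := a')
  have h3 := G₁.adj_comm a a'
  grind

theorem du_rr {A B : Type*} {G₁ : SimpleGraph A} {G₂ : SimpleGraph B} (a a' : B) :
    (disjUnionGraph G₁ G₂).Adj (Sum.inr a) (Sum.inr a') ↔ G₂.Adj a a' := by
  simp only [disjUnionGraph, SimpleGraph.fromRel_adj]
  have h2 := G₂.ne_of_adj (a := a) (b := a')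
  have h3 := G₂.adj_comm a a'
  grind

theorem du_lr {A B : Type*} {G₁ : SimpleGraph A} {G₂ : SimpleGraph B} (a : A) (b : B) :
    ¬ (disjUnionGraph G₁ G₂).Adj (Sum.inl a) (Sum.inr b) := by
  simp [disjUnionGraph, SimpleGraph.fromRel_adj]

theorem card_lt_of_not_cc {V : Type*} [Fintype V] {G : SimpleGraph V} {q : ℕ}
    (h : ¬ CliqueCoverable G q Set.univ) : q < Fintype.card V := by
  by_contra hc
  exact h (cc_of (not_lt.mp hc) (fun v => {v}) (fun v => by simp) (fun x _ => ⟨x, rfl⟩))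

theorem cc_succ {V : Type*} [Fintype V] {G : SimpleGraph V} {q : ℕ}
    (h : MemF1 q G) (S : Set V) : CliqueCoverable G (q + 1) S := by
  have hpos := card_lt_of_not_cc h.2.1
  obtain ⟨v⟩ : Nonempty V := Fintype.card_pos_iff.mp (by omega)
  obtain ⟨f, hf, hS⟩ := h.2.2 {v}ᶜ (by
    intro h0
    have : v ∈ ({v}ᶜ : Set V) := h0 ▸ Set.mem_univ v
    exact this rfl)
  refine cc_of (ι := Option (Fin q)) (by simp) (fun o => o.elim {v} f) ?_ ?_
  · rintro (_ | i)
    · simp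
    · exact hf i
  · intro x _
    by_cases hx : x = v
    · exact ⟨none, hx⟩
    · have : x ∈ ⋃ i, f i := hS ▸ (show x ∈ ({v}ᶜ : Set V) from hx)
      obtain ⟨i, hi⟩ := Set.mem_iUnion.mp this
      exact ⟨some i, hi⟩

theorem cc_join {A B : Type*} {G₁ : SimpleGraph A} {G₂ : SimpleGraph B} {p q r : ℕ}
    (hr : p + q = r) (S : Set (A ⊕ B))
    (h₁ : CliqueCoverable G₁ p (Sum.inl ⁻¹' S)) (h₂ : CliqueCoverable G₂ q (Sum.inr ⁻¹' S)) :
    CliqueCoverable (disjUnionGraph G₁ G₂) r S := by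
  obtain ⟨f, hf, hfS⟩ := h₁
  obtain ⟨g, hg, hgS⟩ := h₂
  refine cc_of (ι := Fin p ⊕ Fin q) (by simp [hr])
    (Sum.elim (fun i => Sum.inl '' f i) (fun i => Sum.inr '' g i)) ?_ ?_
  · rintro (i | i)
    · rintro _ ⟨x, hx, rfl⟩ _ ⟨y, hy, rfl⟩ hxy
      exact (du_ll x y).mpr (hf i hx hy (fun h => hxy (h ▸ rfl)))
    · rintro _ ⟨x, hx, rfl⟩ _ ⟨y, hy, rfl⟩ hxy
      exact (du_rr x y).mpr (hg i hx hy (fun h => hxy (h ▸ rfl)))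
  · rintro (x | x) hx
    · have : x ∈ ⋃ i, f i := hfS ▸ (show x ∈ Sum.inl ⁻¹' S from hx)
      obtain ⟨i, hi⟩ := Set.mem_iUnion.mp this
      exact ⟨Sum.inl i, x, hi, rfl⟩
    · have : x ∈ ⋃ i, g i := hgS ▸ (show x ∈ Sum.inr ⁻¹' S from hx)
      obtain ⟨i, hi⟩ := Set.mem_iUnion.mp this
      exact ⟨Sum.inr i, x, hi, rfl⟩

theorem not_cc_join {A B : Type*} {G₁ : SimpleGraph A} {G₂ : SimpleGraph B} {p q : ℕ}
    (h₁ : ¬ CliqueCoverable G₁ p Set.univ) (h₂ : ¬ CliqueCoverable G₂ q Set.univ) :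
    ¬ CliqueCoverable (disjUnionGraph G₁ G₂) (p + q + 1) Set.univ := by
  classical
  rintro ⟨f, hf, hS⟩
  have hcov : ∀ x, ∃ i, x ∈ f i := fun x => Set.mem_iUnion.mp (hS ▸ Set.mem_univ x)
  let P : Fin (p + q + 1) → Prop := fun i => ∃ a, Sum.inl a ∈ f i
  have hA : p < Fintype.card {i // P i} := by
    by_contra hc
    refine h₁ (cc_of (not_lt.mp hc) (fun i => Sum.inl ⁻¹' f i.1) ?_ ?_)
    · intro i x hx y hy hxy
      exact (du_ll x y).mp (hf i.1 hx hy (fun h => hxy (Sum.inl_injective h)))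
    · intro x _
      obtain ⟨i, hi⟩ := hcov (Sum.inl x)
      exact ⟨⟨i, x, hi⟩, hi⟩
  have hB : q < Fintype.card {i // ¬ P i} := by
    by_contra hc
    refine h₂ (cc_of (not_lt.mp hc) (fun i => Sum.inr ⁻¹' f i.1) ?_ ?_)
    · intro i x hx y hy hxy
      exact (du_rr x y).mp (hf i.1 hx hy (fun h => hxy (Sum.inr_injective h)))
    · intro x _
      obtain ⟨i, hi⟩ := hcov (Sum.inr x)
      exact ⟨⟨i, fun ⟨a, ha⟩ => du_lr a x (hf i ha hi (by simp))⟩, hi⟩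
  have := Fintype.card_subtype_compl P
  have h3 := Fintype.card_subtype_le P
  simp only [Fintype.card_fin] at this h3
  omega

/-- if `G₁ ∈ 𝓕_{q₁,1}` and `G₂ ∈ 𝓕_{q₂,1}` with `q₁, q₂ ≥ 2`, then
`G₁ ⊔ G₂ ∈ 𝓕_{q₁+q₂+1,1}`. -/
theorem memF1_disjUnion {A B : Type*} [Fintype A] [Fintype B] [DecidableEq A] [DecidableEq B]
    (q₁ q₂ : ℕ) (hq₁ : 2 ≤ q₁) (hq₂ : 2 ≤ q₂)
    (G₁ : SimpleGraph A) (G₂ : SimpleGraph B)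
    (h₁ : MemF1 q₁ G₁) (h₂ : MemF1 q₂ G₂) :
    MemF1 (q₁ + q₂ + 1) (disjUnionGraph G₁ G₂) := by
  refine ⟨?_, not_cc_join h₁.2.1 h₂.2.1, ?_⟩
  · rintro ⟨hc, hb⟩
    have ha := card_lt_of_not_cc h₁.2.1
    have hb' := card_lt_of_not_cc h₂.2.1
    rw [Fintype.card_sum] at hc
    refine h₁.1 ⟨by omega, ?_⟩
    ext x y
    rw [← du_ll (G₂ := G₂), hb]
    simp
  · intro S hS
    obtain ⟨x, hx⟩ := (Set.ne_univ_iff_exists_notMem S).mp hS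
    rcases x with x | x
    · exact cc_join (p := q₁) (q := q₂ + 1) (by omega) S
        (h₁.2.2 _ ((Set.ne_univ_iff_exists_notMem _).mpr ⟨x, hx⟩)) (cc_succ h₂ _)
    · exact cc_join (p := q₁ + 1) (q := q₂) (by omega) S (cc_succ h₁ _)
        (h₂.2.2 _ ((Set.ne_univ_iff_exists_notMem _).mpr ⟨x, hx⟩))
end
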